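/- Let 1 ≤ p ≤ n−1 and 1 ≤ l ≤ n. Then for all but finitely many r ∈ S the commutators [Σ_{k=1}^{m} psi_k^p(−r) psibar_k^{p+1}(r), A_l] and [Σ_{k=1}^{m} psi_k^p(−r) psibar_k^{p+1}(r), Abar_l] vanish, and the (finite) sums satisfy Σ_{r∈S} [Σ_{k=1}^{m} psi_k^p(−r) psibar_k^{p+1}(r), A_l] = 0 and Σ_{r∈S} [Σ_{k=1}^{m} psi_k^p(−r) psibar_k^{p+1}(r), Abar_l] = 0 in W_N(S). -/

import Mathlib

noncomputable section

/-- Context for the enlarged Weyl algebra `W_N(S)` with `N = m·n` and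
`S = ℤ` (encoded by `sig = 0`) or `S = ℤ + 1/2` (encoded by `sig = 1`).
An element `r ∈ S` is encoded by the unique integer `k` with `r = k + sig/2`,
so that `ε := 1/2 - sig/2` and e.g. `r > 0 ↔ 0 < 2k + sig`.
The data also fixes a generic `q ∈ ℂˣ` together with a square root `sq` of `q`. -/
structure WCtx where
  m : ℕ
  n : ℕ
  hm : 0 < m
  hn : 0 < n
  sig : ℤ
  hsig : sig = 0 ∨ sig = 1
  q : ℂ
  sq : ℂ
  hsq : sq ^ 2 = q
  hq0 : q ≠ 0
  hqu : ∀ k : ℕ, k ≠ 0 → q ^ k ≠ 1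

namespace WCtx

variable (C : WCtx)

/-- `N = m n`. -/
def NN : ℕ := C.m * C.n

/-- Names of the generators of `W_N(S)`: `Sum.inl i` is `ψ_{i+1}` and
`Sum.inr i` is `ψ̄_{i+1}`; the integer `k` encodes the index `r = k + sig/2 ∈ S`. -/
abbrev Gen : Type := (Fin C.NN ⊕ Fin C.NN) × ℤ

/-- The defining relations of the enlarged Weyl algebra `W_N(S)`:
any two `ψ`'s commute, any two `ψ̄`'s commute, and
`ψ̄_i(k)ψ_j(r) − ψ_j(r)ψ̄_i(k) = δ_{i,j} δ_{k+r,0}`. -/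
inductive rel : FreeAlgebra ℂ C.Gen → FreeAlgebra ℂ C.Gen → Prop
  | comm_psi (i j : Fin C.NN) (k l : ℤ) :
      rel (FreeAlgebra.ι ℂ ((Sum.inl i, k) : C.Gen) * FreeAlgebra.ι ℂ ((Sum.inl j, l) : C.Gen))
          (FreeAlgebra.ι ℂ ((Sum.inl j, l) : C.Gen) * FreeAlgebra.ι ℂ ((Sum.inl i, k) : C.Gen))
  | comm_psibar (i j : Fin C.NN) (k l : ℤ) :
      rel (FreeAlgebra.ι ℂ ((Sum.inr i, k) : C.Gen) * FreeAlgebra.ι ℂ ((Sum.inr j, l) : C.Gen))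
          (FreeAlgebra.ι ℂ ((Sum.inr j, l) : C.Gen) * FreeAlgebra.ι ℂ ((Sum.inr i, k) : C.Gen))
  | mixed (i j : Fin C.NN) (k l : ℤ) :
      rel (FreeAlgebra.ι ℂ ((Sum.inr i, k) : C.Gen) * FreeAlgebra.ι ℂ ((Sum.inl j, l) : C.Gen))
          (FreeAlgebra.ι ℂ ((Sum.inl j, l) : C.Gen) * FreeAlgebra.ι ℂ ((Sum.inr i, k) : C.Gen)
            + (if i = j ∧ k + l + C.sig = 0 then 1 else 0))

/-- The enlarged Weyl algebra `W_N(S)`. -/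
def W : Type := RingQuot C.rel

instance : Ring C.W := inferInstanceAs (Ring (RingQuot C.rel))
instance : Algebra ℂ C.W := inferInstanceAs (Algebra ℂ (RingQuot C.rel))

/-- `ψ` with `0`-indexed flat subscript. -/
def psi0 (i : Fin C.NN) (k : ℤ) : C.W :=
  RingQuot.mkAlgHom ℂ C.rel (FreeAlgebra.ι ℂ ((Sum.inl i, k) : C.Gen))

/-- `ψ̄` with `0`-indexed flat subscript. -/
def psibar0 (i : Fin C.NN) (k : ℤ) : C.W :=
  RingQuot.mkAlgHom ℂ C.rel (FreeAlgebra.ι ℂ ((Sum.inr i, k) : C.Gen))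

/-- `ψ_i(r)` with `1`-indexed flat subscript `i ∈ {1,…,N}` (junk value `0` outside). -/
def psiF (i : ℕ) (k : ℤ) : C.W :=
  if h : 1 ≤ i ∧ i ≤ C.NN then C.psi0 ⟨i - 1, by omega⟩ k else 0

/-- `ψ̄_i(r)` with `1`-indexed flat subscript `i ∈ {1,…,N}` (junk value `0` outside). -/
def psibarF (i : ℕ) (k : ℤ) : C.W :=
  if h : 1 ≤ i ∧ i ≤ C.NN then C.psibar0 ⟨i - 1, by omega⟩ k else 0

/-- `ψ_i^c(r) = ψ_{i+(c-1)m}(r)`, subscript `i ∈ {1,…,m}`, superscript `c ∈ {1,…,n}`. -/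
def psiS (i c : ℕ) (k : ℤ) : C.W := C.psiF (i + (c - 1) * C.m) k

/-- `ψ̄_i^c(r) = ψ̄_{i+(c-1)m}(r)`. -/
def psibarS (i c : ℕ) (k : ℤ) : C.W := C.psibarF (i + (c - 1) * C.m) k

/-- The left ideal of `W_N(S)` generated by all `ψ_i(r), ψ̄_i(r)` with `r > 0`,
together with all `ψ̄_i(0)` when `S = ℤ`. -/
def vacIdeal : Submodule C.W C.W :=
  Submodule.span C.W
    {w : C.W |
      (∃ (i : Fin C.NN) (k : ℤ), 0 < 2 * k + C.sig ∧ (w = C.psi0 i k ∨ w = C.psibar0 i k)) ∨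
        (C.sig = 0 ∧ ∃ i : Fin C.NN, w = C.psibar0 i 0)}

/-- The Fock module `F_N(S) = W_N(S)/I`. -/
def F : Type := C.W ⧸ C.vacIdeal

instance : AddCommGroup C.F := inferInstanceAs (AddCommGroup (C.W ⧸ C.vacIdeal))
instance : Module C.W C.F := inferInstanceAs (Module C.W (C.W ⧸ C.vacIdeal))
instance : Module ℂ C.F := inferInstanceAs (Module ℂ (C.W ⧸ C.vacIdeal))

/-- The vacuum vector `|0⟩ ∈ F_N(S)`. -/
def vac : C.F := Submodule.Quotient.mk (1 : C.W)

/-- Normal ordering `:u(k) v(l):` where `l` encodes the `S`-index of the second factor. -/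
def nord (u : C.W) (l : ℤ) (v : C.W) : C.W :=
  if 0 < 2 * l + C.sig then u * v
  else if 2 * l + C.sig = 0 then (2 : ℂ)⁻¹ • (u * v + v * u)
  else v * u

/-- `ε = 0` if `S = ℤ + 1/2`, `ε = 1/2` if `S = ℤ`, as a complex number. -/
def eps : ℂ := (1 - (C.sig : ℂ)) / 2

/-- `ω_S(b)`. -/
def om (b : ℤ) : ℂ :=
  if b = 0 then 0
  else if C.sig = 0 then (2 : ℂ)⁻¹ * ((C.q ^ b + 1) / (C.q ^ b - 1))
  else C.sq ^ b / (C.q ^ b - 1)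

/-- `q^{-b r}` for `r = k + sig/2 ∈ S`. -/
def qp (b k : ℤ) : ℂ := C.sq ^ (-(b * (2 * k + C.sig)))

/-- `q^{b r}` for `r = k + sig/2 ∈ S`. -/
def qpp (b k : ℤ) : ℂ := C.sq ^ (b * (2 * k + C.sig))

/-- `φ^c_{t + sig/2}`; here `t ∈ ℤ` encodes the half-integer index `t + sig/2 = t + 1/2 - ε`.
Writing `t = (k + sig)m - i` with `1 ≤ i ≤ m`, `k ∈ ℤ`, this is `ψ_i^c(k + sig/2)`. -/
def PhiW (c : ℕ) (t : ℤ) : C.W :=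
  C.psiF ((((-t - 1).emod C.m).toNat + 1) + (c - 1) * C.m)
    ((t + (-t - 1).emod C.m + 1) / C.m - C.sig)

/-- `φ̄^c_{t + sig/2}`; writing `t = k·m + i - 1` with `1 ≤ i ≤ m`, `k ∈ ℤ`,
this is `ψ̄_i^c(k + sig/2)`. -/
def PhibarW (c : ℕ) (t : ℤ) : C.W :=
  C.psibarF (((t.emod C.m).toNat + 1) + (c - 1) * C.m) ((t - t.emod C.m) / C.m)

/-- Determinant of a square matrix with (pairwise commuting) entries in `W_N(S)`. -/
def ncdet {l : ℕ} (M : Fin l → Fin l → C.W) : C.W :=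
  ∑ p : Equiv.Perm (Fin l),
    (((Equiv.Perm.sign p : ℤˣ) : ℤ)) • ((List.finRange l).map fun t => M (p t) t).prod

/-- The element `A_l ∈ W_N(S)`, `1 ≤ l ≤ n`. -/
def Adet (l : ℕ) : C.W :=
  C.ncdet fun k t : Fin l => C.PhiW ((k : ℕ) + 1) (-(((t : ℕ) : ℤ) + 1))

/-- The element `Ā_l ∈ W_N(S)`, `1 ≤ l ≤ n`. -/
def Abar (l : ℕ) : C.W :=
  C.ncdet fun s t : Fin (C.n - l + 1) => C.PhibarW (C.n - (s : ℕ)) (-(((t : ℕ) : ℤ) + 1))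

/-- `α(r,a,i) = (a - r + 1/2 - ε)m - i + 1 = (a-k)m - i + 1` for `r = k + sig/2`. -/
def alphaV (k a : ℤ) (i : ℕ) : ℤ := (a - k) * C.m - (i : ℤ) + 1

/-- `β(r,a,j) = (r + a - 1/2 + ε)m + j = (k+a)m + j` for `r = k + sig/2`. -/
def betaV (k a : ℤ) (j : ℕ) : ℤ := (k + a) * C.m + (j : ℤ)

/-- `Σ_{c=1}^{n} ψ_i^c(a-r) ψ̄_j^c(r)`, where `k` encodes `r`. -/
def Esum (i j : ℕ) (a k : ℤ) : C.W :=
  ∑ c : Fin C.n, C.psiS i ((c : ℕ) + 1) (a - k - C.sig) * C.psibarS j ((c : ℕ) + 1) k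

/-- `A_l^{i,j,r}`: `A_l` with the `β(r,0,j)`-th column replaced by
`(φ^1_{α(r,a,i)-1/2-ε}, …, φ^l_{α(r,a,i)-1/2-ε})ᵗ`. -/
def Amod (l : ℕ) (i j : ℕ) (a k : ℤ) : C.W :=
  C.ncdet fun r t : Fin l =>
    if (((t : ℕ) : ℤ) + 1) = C.betaV k 0 j then C.PhiW ((r : ℕ) + 1) (C.alphaV k a i - 1)
    else C.PhiW ((r : ℕ) + 1) (-(((t : ℕ) : ℤ) + 1))

/-- `Ā_l^{i,j,r}`: `Ā_l` with the `α(r,a,i)`-th column replaced by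
`(-φ̄^n_{β(r,0,j)-1/2-ε}, …, -φ̄^l_{β(r,0,j)-1/2-ε})ᵗ`. -/
def Abarmod (l : ℕ) (i j : ℕ) (a k : ℤ) : C.W :=
  C.ncdet fun s t : Fin (C.n - l + 1) =>
    if (((t : ℕ) : ℤ) + 1) = C.alphaV k a i then -C.PhibarW (C.n - (s : ℕ)) (C.betaV k 0 j - 1)
    else C.PhibarW (C.n - (s : ℕ)) (-(((t : ℕ) : ℤ) + 1))

/-- `l̄₁` for `l = l₁ m + l₂`, `1 ≤ l₂ ≤ m`. -/
def lb1 (l : ℕ) : ℕ :=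
  if (l - 1) / C.m % 2 = 0 then ((l - 1) / C.m / 2) * C.m + ((l - 1) % C.m + 1)
  else (((l - 1) / C.m + 1) / 2) * C.m

/-- `l̄₂ = l - l̄₁`. -/
def lb2 (l : ℕ) : ℕ := l - C.lb1 l

/-- The `(k,t)` entry of the matrix defining `B_l`. -/
def Bentry (l : ℕ) (k t : Fin l) : C.W :=
  if (t : ℕ) + 1 ≤ C.lb1 l then C.PhiW ((k : ℕ) + 1) (-(((t : ℕ) : ℤ) + 1))
  else C.PhibarW (C.n - (k : ℕ)) (-((((t : ℕ) : ℤ) + 1) - (C.lb1 l : ℤ)))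

/-- The element `B_l ∈ W_N(S)`, `1 ≤ l ≤ n`. -/
def Bdet (l : ℕ) : C.W := C.ncdet (C.Bentry l)

/-- The element `B̄_{n/2} ∈ W_N(S)` (`n` even): `B_{n/2}` with its `(n/2)`-th row replaced. -/
def Bbar : C.W :=
  C.ncdet fun k t : Fin (C.n / 2) =>
    if (k : ℕ) + 1 = C.n / 2 then
      (if (t : ℕ) + 1 ≤ C.lb1 (C.n / 2) then C.PhiW (C.n / 2 + 1) (-(((t : ℕ) : ℤ) + 1))
       else C.PhibarW (C.n / 2) (-((((t : ℕ) : ℤ) + 1) - (C.lb1 (C.n / 2) : ℤ))))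
    else C.Bentry (C.n / 2) k t

/-- `B_l` with its `pos`-th column replaced by the column `(col 1, …, col l)ᵗ`. -/
def Bcolrep (l : ℕ) (pos : ℤ) (col : ℕ → C.W) : C.W :=
  C.ncdet fun k t : Fin l =>
    if (((t : ℕ) : ℤ) + 1) = pos then col ((k : ℕ) + 1) else C.Bentry l k t

/-- The operator `T_{i,j}(a,b) = Σ_{r∈S} q^{-br} Σ_{c=1}^n :ψ_i^c(a-r) ψ̄_j^c(r):`. -/
def Top (i j : ℕ) (a b : ℤ) (x : C.F) : C.F :=
  ∑ᶠ k : ℤ, (C.qp b k • ∑ c : Fin C.n,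
    C.nord (C.psiS i ((c : ℕ) + 1) (a - k - C.sig)) k (C.psibarS j ((c : ℕ) + 1) k)) • x

/-- The operator `S_{i,j}(c,d) = Σ_{e=1}^n ψ_i^e(c) ψ̄_j^e(d)`. -/
def Sop (i j : ℕ) (c d : ℤ) (x : C.F) : C.F :=
  (∑ e : Fin C.n, C.psiS i ((e : ℕ) + 1) c * C.psibarS j ((e : ℕ) + 1) d) • x

/-- The operator `E_{p,p} = Σ_{c=1}^m Σ_{r∈S} :ψ_c^p(-r) ψ̄_c^p(r): − ε m`. -/
def Epp (p : ℕ) (x : C.F) : C.F :=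
  (∑ᶠ k : ℤ, (∑ c : Fin C.m,
      C.nord (C.psiS ((c : ℕ) + 1) p (-k - C.sig)) k (C.psibarS ((c : ℕ) + 1) p k)) • x)
    - (C.eps * (C.m : ℂ)) • x

/-- The operator `E_i(b) = Σ_{r∈S} q^{-br} Σ_{c=1}^n :ψ_i^c(-r) ψ̄_i^c(r): − n ω_S(b)`. -/
def Eib (i : ℕ) (b : ℤ) (x : C.F) : C.F :=
  (∑ᶠ k : ℤ, (C.qp b k • ∑ c : Fin C.n,
      C.nord (C.psiS i ((c : ℕ) + 1) (-k - C.sig)) k (C.psibarS i ((c : ℕ) + 1) k)) • x)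
    - ((C.n : ℂ) * C.om b) • x

/-- `Σ_{r ∈ J^S_{i,l}} q^{-br}`. -/
def Jsum (i l : ℕ) (b : ℤ) : ℂ :=
  ∑ᶠ k ∈ {k : ℤ | 1 ≤ k * (C.m : ℤ) + (i : ℤ) ∧ k * (C.m : ℤ) + (i : ℤ) ≤ (l : ℤ)}, C.qp b k

/-- `Σ_{r ∈ J̄^S_{i,l}} q^{-br}`. -/
def Jbarsum (i l : ℕ) (b : ℤ) : ℂ :=
  ∑ᶠ k ∈ {k : ℤ | 1 ≤ -(k * (C.m : ℤ)) - (i : ℤ) + 1 ∧ -(k * (C.m : ℤ)) - (i : ℤ) + 1 ≤ (l : ℤ)},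
    C.qp b k

/-- `Σ_{r ∈ J^S_{i,l}} q^{br}`. -/
def JsumP (i l : ℕ) (b : ℤ) : ℂ :=
  ∑ᶠ k ∈ {k : ℤ | 1 ≤ k * (C.m : ℤ) + (i : ℤ) ∧ k * (C.m : ℤ) + (i : ℤ) ≤ (l : ℤ)}, C.qpp b k

/-- `Σ_{c=1}^m ψ_c^p(-r) ψ̄_c^{p+1}(r)` (no normal ordering), `k` encoding `r ∈ S`. -/
def glRaise (p : ℕ) (k : ℤ) : C.W :=
  ∑ c : Fin C.m, C.psiS ((c : ℕ) + 1) p (-k - C.sig) * C.psibarS ((c : ℕ) + 1) (p + 1) k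

/-- The operator `Σ_{c=1}^m Σ_{r∈S} :ψ_c^p(-r) ψ̄_c^{p+1}(r):`. -/
def glRaiseOp (p : ℕ) (x : C.F) : C.F :=
  ∑ᶠ k : ℤ, (∑ c : Fin C.m,
    C.nord (C.psiS ((c : ℕ) + 1) p (-k - C.sig)) k (C.psibarS ((c : ℕ) + 1) (p + 1) k)) • x

end WCtx

/-- The commutator of `g` with a product is zero if `g` commutes with every factor. -/
lemma comm_list_prod_eq_zero {R ι : Type*} [Ring R] (g : R) (L : List ι) (f : ι → R)
    (h : ∀ t ∈ L, g * f t - f t * g = 0) :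
    g * (L.map f).prod - (L.map f).prod * g = 0 := by
  rw [sub_eq_zero]
  refine (Commute.list_prod_right _ _ ?_).eq
  intro x hx
  obtain ⟨t, ht, rfl⟩ := List.mem_map.1 hx
  exact sub_eq_zero.1 (h t ht)

/-- Leibniz rule for a product in which `g` fails to commute with a single factor. -/
lemma comm_list_prod_eq_update {R ι : Type*} [Ring R] [DecidableEq ι] (g v : R) (L : List ι)
    (hL : L.Nodup) (f : ι → R) (t₀ : ι) (ht₀ : t₀ ∈ L) (h₀ : g * f t₀ - f t₀ * g = v)
    (h : ∀ t, t ≠ t₀ → g * f t - f t * g = 0) :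
    g * (L.map f).prod - (L.map f).prod * g = (L.map (Function.update f t₀ v)).prod := by
  induction L with
  | nil => simp at ht₀
  | cons x L ih =>
    obtain ⟨hx, hL⟩ := List.nodup_cons.1 hL
    simp only [List.map_cons, List.prod_cons]
    have key : g * (f x * (L.map f).prod) - f x * (L.map f).prod * g
        = (g * f x - f x * g) * (L.map f).prod
          + f x * (g * (L.map f).prod - (L.map f).prod * g) := by noncomm_ring
    rw [key]
    by_cases hxt : x = t₀
    · subst hxt
      have hne : ∀ t ∈ L, t ≠ x := fun t ht e => hx (e ▸ ht)
      rw [comm_list_prod_eq_zero g L f fun t ht => h t (hne t ht), h₀,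
        List.map_congr_left (g := f) (f := Function.update f x v)
          fun t ht => Function.update_of_ne (hne t ht) _ _]
      simp
    · rw [h x hxt, ih hL ((List.mem_cons.1 ht₀).resolve_left (Ne.symm hxt)),
        Function.update_of_ne hxt]
      simp

namespace WCtx

variable (C : WCtx)

/-- `ncdet` vanishes on matrices with two equal rows. -/
lemma ncdet_eq_zero_of_row_eq {l : ℕ} (M : Fin l → Fin l → C.W) {a b : Fin l} (hab : a ≠ b)
    (h : M a = M b) : C.ncdet M = 0 := by
  have hswap : ∀ i, M (Equiv.swap a b i) = M i := by
    intro i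
    rcases eq_or_ne i a with rfl | hia
    · rw [Equiv.swap_apply_left, h]
    · rcases eq_or_ne i b with rfl | hib
      · rw [Equiv.swap_apply_right, h]
      · rw [Equiv.swap_apply_of_ne_of_ne hia hib]
  refine Finset.sum_involution (fun σ _ => Equiv.swap a b * σ) ?_ ?_ ?_ ?_
  · intro σ _
    simp [Equiv.Perm.sign_mul, Equiv.Perm.sign_swap hab, hswap]
  · intro σ _ _ e
    exact hab (Equiv.swap_eq_one_iff.1 (mul_eq_right.1 e))
  · simp
  · intro σ _
    simp

/-- An element commuting with all entries commutes with `ncdet`. -/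
lemma comm_ncdet_eq_zero {l : ℕ} (g : C.W) (M : Fin l → Fin l → C.W)
    (h : ∀ i j, g * M i j - M i j * g = 0) :
    g * C.ncdet M - C.ncdet M * g = 0 := by
  simp only [ncdet, Finset.mul_sum, Finset.sum_mul, mul_smul_comm, smul_mul_assoc,
    ← Finset.sum_sub_distrib, ← smul_sub]
  refine Finset.sum_eq_zero fun σ _ => ?_
  rw [comm_list_prod_eq_zero _ _ _ fun t _ => h _ _, smul_zero]

/-- If `[g, ·]` sends row `a` to row `b ≠ a` and kills all other rows, then `g` commutes
with `ncdet`. -/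
lemma comm_ncdet_eq_zero_of_row {l : ℕ} (g : C.W) (M : Fin l → Fin l → C.W) {a b : Fin l}
    (hab : a ≠ b) (ha : ∀ j, g * M a j - M a j * g = M b j)
    (h : ∀ i j, i ≠ a → g * M i j - M i j * g = 0) :
    g * C.ncdet M - C.ncdet M * g = 0 := by
  rw [← C.ncdet_eq_zero_of_row_eq (Function.update M a (M b)) hab
    (by rw [Function.update_self, Function.update_of_ne hab.symm])]
  simp only [ncdet, Finset.mul_sum, Finset.sum_mul, mul_smul_comm, smul_mul_assoc,
    ← Finset.sum_sub_distrib, ← smul_sub]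
  refine Finset.sum_congr rfl fun σ _ => ?_
  rw [comm_list_prod_eq_update g (M b (σ.symm a)) _ (List.nodup_finRange l) _ (σ.symm a)
    (List.mem_finRange _) (by simpa using ha _)
    fun t ht => h _ _ fun e => ht (by rw [← e, Equiv.symm_apply_apply])]
  congr 3
  funext t
  by_cases ht : t = σ.symm a
  · subst ht; simp
  · have : σ t ≠ a := fun e => ht (by rw [← e, Equiv.symm_apply_apply])
    rw [Function.update_of_ne ht, Function.update_of_ne this]

/-- If a family of inner derivations sums to one that sends a single row to another row and
kills the remaining rows, then the commutators with `ncdet` sum to zero. -/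
lemma finsum_comm_ncdet {l : ℕ} (G : ℤ → C.W) (M : Fin l → Fin l → C.W) (ρ : Fin l → Prop)
    [DecidablePred ρ] (κ : Fin l → ℤ) (v : Fin l → C.W)
    (hG : ∀ k i j, G k * M i j - M i j * G k = if ρ i ∧ k = κ j then v j else 0)
    (hρ : ∀ a, ρ a → (∀ i, ρ i → i = a) ∧ ∃ b, a ≠ b ∧ ∀ j, M b j = v j) :
    {k : ℤ | G k * C.ncdet M - C.ncdet M * G k ≠ 0}.Finite ∧
      ∑ᶠ k : ℤ, (G k * C.ncdet M - C.ncdet M * G k) = 0 := by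
  have hsub : (Function.support fun k => G k * C.ncdet M - C.ncdet M * G k)
      ⊆ ((Finset.univ.image κ : Finset ℤ) : Set ℤ) := by
    intro k hk
    by_contra hkT
    refine hk (C.comm_ncdet_eq_zero _ _ fun i j => ?_)
    rw [hG, if_neg]
    rintro ⟨-, rfl⟩
    exact hkT (by simp)
  refine ⟨(Finset.finite_toSet _).subset hsub, ?_⟩
  rw [finsum_eq_sum_of_support_subset _ hsub, Finset.sum_sub_distrib, ← Finset.sum_mul,
    ← Finset.mul_sum]
  have hsum : ∀ i j, (∑ k ∈ Finset.univ.image κ, G k) * M i j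
      - M i j * (∑ k ∈ Finset.univ.image κ, G k) = if ρ i then v j else 0 := by
    intro i j
    rw [Finset.sum_mul, Finset.mul_sum, ← Finset.sum_sub_distrib]
    simp only [hG]
    by_cases hi : ρ i <;> simp [hi]
  by_cases hex : ∃ a, ρ a
  · obtain ⟨a, ha⟩ := hex
    obtain ⟨huniq, b, hab, hb⟩ := hρ a ha
    refine C.comm_ncdet_eq_zero_of_row _ _ hab (fun j => ?_) fun i j hi => ?_
    · rw [hsum, if_pos ha, hb]
    · rw [hsum, if_neg fun e => hi (huniq i e)]
  · exact C.comm_ncdet_eq_zero _ _ fun i j => by rw [hsum, if_neg fun e => hex ⟨i, e⟩]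

lemma psiF_mul_comm (i j : ℕ) (k r : ℤ) : C.psiF i k * C.psiF j r = C.psiF j r * C.psiF i k := by
  unfold psiF
  split_ifs <;> try simp only [zero_mul, mul_zero]
  have h := RingQuot.mkAlgHom_rel ℂ (rel.comm_psi (C := C) ⟨i - 1, by omega⟩ ⟨j - 1, by omega⟩ k r)
  rw [map_mul, map_mul] at h
  exact h

lemma psibarF_mul_comm (i j : ℕ) (k r : ℤ) :
    C.psibarF i k * C.psibarF j r = C.psibarF j r * C.psibarF i k := by
  unfold psibarF
  split_ifs <;> try simp only [zero_mul, mul_zero]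
  have h := RingQuot.mkAlgHom_rel ℂ
    (rel.comm_psibar (C := C) ⟨i - 1, by omega⟩ ⟨j - 1, by omega⟩ k r)
  rw [map_mul, map_mul] at h
  exact h

lemma psibarF_mul_psiF (i j : ℕ) (k r : ℤ) (hi : 1 ≤ i ∧ i ≤ C.NN) (hj : 1 ≤ j ∧ j ≤ C.NN) :
    C.psibarF i k * C.psiF j r
      = C.psiF j r * C.psibarF i k + if i = j ∧ k + r + C.sig = 0 then 1 else 0 := by
  rw [psiF, psibarF, dif_pos hi, dif_pos hj]
  have h := RingQuot.mkAlgHom_rel ℂ (rel.mixed (C := C) ⟨i - 1, by omega⟩ ⟨j - 1, by omega⟩ k r)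
  rw [map_mul, map_add, map_mul] at h
  refine Eq.trans h (congrArg _ ?_)
  have hij : (⟨i - 1, by omega⟩ : Fin C.NN) = ⟨j - 1, by omega⟩ ↔ i = j := by
    rw [Fin.mk.injEq]; omega
  simp only [hij]
  split_ifs
  · exact map_one (RingQuot.mkAlgHom ℂ C.rel)
  · exact map_zero (RingQuot.mkAlgHom ℂ C.rel)

lemma flat_index_bounds {i c : ℕ} (hi : i < C.m) (hc : 1 ≤ c) (hc' : c ≤ C.n) :
    1 ≤ i + 1 + (c - 1) * C.m ∧ i + 1 + (c - 1) * C.m ≤ C.NN := by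
  obtain ⟨d, rfl⟩ := Nat.exists_eq_add_of_le hc
  have h := Nat.mul_le_mul_left C.m hc'
  refine ⟨by omega, ?_⟩
  rw [NN, Nat.add_sub_cancel_left]
  nlinarith

lemma flat_index_inj {i j c d : ℕ} (hi : i < C.m) (hj : j < C.m) (hc : 1 ≤ c) (hd : 1 ≤ d) :
    i + 1 + (c - 1) * C.m = j + 1 + (d - 1) * C.m ↔ i = j ∧ c = d := by
  refine ⟨fun h => ?_, fun ⟨h₁, h₂⟩ => by rw [h₁, h₂]⟩
  have h' : i + (c - 1) * C.m = j + (d - 1) * C.m := by omega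
  have hmod := congrArg (· % C.m) h'
  have hdiv := congrArg (· / C.m) h'
  simp only [Nat.add_mul_mod_self_right, Nat.mod_eq_of_lt hi, Nat.mod_eq_of_lt hj] at hmod
  simp only [Nat.add_mul_div_right _ _ C.hm, Nat.div_eq_of_lt hi, Nat.div_eq_of_lt hj] at hdiv
  omega

lemma psibarS_mul_psiS {i j c d : ℕ} (k r : ℤ) (hi : i < C.m) (hj : j < C.m)
    (hc : 1 ≤ c) (hc' : c ≤ C.n) (hd : 1 ≤ d) (hd' : d ≤ C.n) :
    C.psibarS (i + 1) c k * C.psiS (j + 1) d r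
      = C.psiS (j + 1) d r * C.psibarS (i + 1) c k
        + if (i = j ∧ c = d) ∧ k + r + C.sig = 0 then 1 else 0 := by
  rw [psibarS, psiS, psibarF_mul_psiF _ _ _ _ _ (C.flat_index_bounds hi hc hc')
    (C.flat_index_bounds hj hd hd')]
  simp only [C.flat_index_inj hi hj hc hd]

lemma glRaise_comm_psiS {p i c : ℕ} (hp' : p + 1 ≤ C.n) (hi : i < C.m)
    (hc : 1 ≤ c) (hc' : c ≤ C.n) (k r : ℤ) :
    C.glRaise p k * C.psiS (i + 1) c r - C.psiS (i + 1) c r * C.glRaise p k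
      = if c = p + 1 ∧ k + r + C.sig = 0 then C.psiS (i + 1) p r else 0 := by
  have hterm : ∀ e : Fin C.m,
      C.psiS (e + 1) p (-k - C.sig) * C.psibarS (e + 1) (p + 1) k * C.psiS (i + 1) c r
        - C.psiS (i + 1) c r * (C.psiS (e + 1) p (-k - C.sig) * C.psibarS (e + 1) (p + 1) k)
      = if e = ⟨i, hi⟩ then
          (if c = p + 1 ∧ k + r + C.sig = 0 then C.psiS (i + 1) p r else 0) else 0 := by
    intro e
    have hcomm : C.psiS (i + 1) c r * C.psiS (e + 1) p (-k - C.sig)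
        = C.psiS (e + 1) p (-k - C.sig) * C.psiS (i + 1) c r := C.psiF_mul_comm _ _ _ _
    rw [mul_assoc, C.psibarS_mul_psiS k r e.2 hi (by omega) hp' hc hc',
      ← mul_assoc _ _ (C.psibarS _ _ _), hcomm, mul_add, mul_assoc,
      add_sub_cancel_left, mul_ite, mul_one, mul_zero, ← ite_and]
    refine ite_congr (propext ?_) ?_ fun _ => rfl
    · rw [Fin.ext_iff, and_assoc, eq_comm (a := p + 1)]
    · rintro ⟨he, -, hk⟩
      rw [he, show r = -k - C.sig by omega]
  rw [glRaise, Finset.sum_mul, Finset.mul_sum, ← Finset.sum_sub_distrib]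
  simp only [hterm, Finset.sum_ite_eq', Finset.mem_univ, if_true]

lemma glRaise_comm_psibarS {p i c : ℕ} (hp : 1 ≤ p) (hp' : p + 1 ≤ C.n) (hi : i < C.m)
    (hc : 1 ≤ c) (hc' : c ≤ C.n) (k r : ℤ) :
    -C.glRaise p k * C.psibarS (i + 1) c r - C.psibarS (i + 1) c r * -C.glRaise p k
      = if c = p ∧ k = r then C.psibarS (i + 1) (p + 1) r else 0 := by
  have hterm : ∀ e : Fin C.m,
      C.psibarS (i + 1) c r * (C.psiS (e + 1) p (-k - C.sig) * C.psibarS (e + 1) (p + 1) k)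
        - C.psiS (e + 1) p (-k - C.sig) * C.psibarS (e + 1) (p + 1) k * C.psibarS (i + 1) c r
      = if e = ⟨i, hi⟩ then
          (if c = p ∧ k = r then C.psibarS (i + 1) (p + 1) r else 0) else 0 := by
    intro e
    have hcomm : C.psibarS (e + 1) (p + 1) k * C.psibarS (i + 1) c r
        = C.psibarS (i + 1) c r * C.psibarS (e + 1) (p + 1) k := C.psibarF_mul_comm _ _ _ _
    rw [← mul_assoc, C.psibarS_mul_psiS r _ hi e.2 hc hc' hp (by omega),
      mul_assoc _ _ (C.psibarS (i + 1) c r), hcomm, add_mul, mul_assoc,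
      add_sub_cancel_left, ite_mul, one_mul, zero_mul, ← ite_and]
    refine ite_congr (propext ?_) ?_ fun _ => rfl
    · rw [Fin.ext_iff, and_assoc, eq_comm (a := i)]
      refine and_congr_right fun _ => and_congr_right fun _ => ?_
      omega
    · rintro ⟨he, -, hk⟩
      rw [he, hk]
  rw [neg_mul, mul_neg, sub_neg_eq_add, neg_add_eq_sub, glRaise, Finset.sum_mul, Finset.mul_sum,
    ← Finset.sum_sub_distrib]
  simp only [hterm, Finset.sum_ite_eq', Finset.mem_univ, if_true]

lemma m_cast_ne_zero : (C.m : ℤ) ≠ 0 := by exact_mod_cast C.hm.ne'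

lemma toNat_emod_lt (t : ℤ) : (t % C.m).toNat < C.m := by
  have := Int.emod_lt_of_pos t (show (0 : ℤ) < C.m by exact_mod_cast C.hm)
  have := C.hm
  omega

lemma PhiW_eq_psiS (c : ℕ) (t : ℤ) :
    C.PhiW c t = C.psiS (((-t - 1) % C.m).toNat + 1) c (-((-t - 1) / C.m) - C.sig) := by
  have h : t + (-t - 1) % C.m + 1 = -((-t - 1) / C.m) * C.m := by
    linarith [Int.emod_add_mul_ediv (-t - 1) C.m]
  have h' : (t + (-t - 1).emod C.m + 1) / C.m = -((-t - 1) / C.m) := by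
    change (t + (-t - 1) % C.m + 1) / C.m = _
    rw [h, Int.mul_ediv_cancel _ C.m_cast_ne_zero]
  rw [PhiW, h']
  rfl

lemma PhibarW_eq_psibarS (c : ℕ) (t : ℤ) :
    C.PhibarW c t = C.psibarS ((t % C.m).toNat + 1) c (t / C.m) := by
  have h : t - t % C.m = t / C.m * C.m := by linarith [Int.emod_add_mul_ediv t C.m]
  have h' : (t - t.emod C.m) / C.m = t / C.m := by
    change (t - t % C.m) / C.m = _
    rw [h, Int.mul_ediv_cancel _ C.m_cast_ne_zero]
  rw [PhibarW, h']
  rfl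

lemma glRaise_comm_PhiW {p c : ℕ} (hp' : p + 1 ≤ C.n) (hc : 1 ≤ c) (hc' : c ≤ C.n) (k t : ℤ) :
    C.glRaise p k * C.PhiW c t - C.PhiW c t * C.glRaise p k
      = if c = p + 1 ∧ k = (-t - 1) / C.m then C.PhiW p t else 0 := by
  rw [PhiW_eq_psiS, PhiW_eq_psiS, C.glRaise_comm_psiS hp' (C.toNat_emod_lt _) hc hc']
  refine ite_congr (propext (and_congr_right fun _ => ?_)) (fun _ => rfl) fun _ => rfl
  constructor <;> intro h <;> linarith

lemma glRaise_comm_PhibarW {p c : ℕ} (hp : 1 ≤ p) (hp' : p + 1 ≤ C.n) (hc : 1 ≤ c)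
    (hc' : c ≤ C.n) (k t : ℤ) :
    -C.glRaise p k * C.PhibarW c t - C.PhibarW c t * -C.glRaise p k
      = if c = p ∧ k = t / C.m then C.PhibarW (p + 1) t else 0 := by
  rw [PhibarW_eq_psibarS, PhibarW_eq_psibarS,
    C.glRaise_comm_psibarS hp hp' (C.toNat_emod_lt _) hc hc']

end WCtx

open WCtx in
/-- **Lemma 5.5.**  For `1 ≤ p ≤ n-1` and `1 ≤ l ≤ n`, all but finitely many of the
commutators `[Σ_c ψ_c^p(-r)ψ̄_c^{p+1}(r), A_l]` and `[Σ_c ψ_c^p(-r)ψ̄_c^{p+1}(r), Ā_l]`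
(`r ∈ S`) vanish, and their (finite) sums over `r ∈ S` are zero. -/
theorem statement8 (C : WCtx) (p : ℕ) (hp : 1 ≤ p) (hp' : p + 1 ≤ C.n)
    (l : ℕ) (hl : 1 ≤ l) (hl' : l ≤ C.n) :
    {k : ℤ | C.glRaise p k * C.Adet l - C.Adet l * C.glRaise p k ≠ 0}.Finite
    ∧ {k : ℤ | C.glRaise p k * C.Abar l - C.Abar l * C.glRaise p k ≠ 0}.Finite
    ∧ (∑ᶠ k : ℤ, (C.glRaise p k * C.Adet l - C.Adet l * C.glRaise p k)) = 0
    ∧ (∑ᶠ k : ℤ, (C.glRaise p k * C.Abar l - C.Abar l * C.glRaise p k)) = 0 := by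
  have hA := C.finsum_comm_ncdet (C.glRaise p)
    (fun k t : Fin l => C.PhiW ((k : ℕ) + 1) (-(((t : ℕ) : ℤ) + 1)))
    (fun k => (k : ℕ) + 1 = p + 1) _ _
    (fun k i j => C.glRaise_comm_PhiW hp' (by omega) (by omega) k _)
    (fun a ha => ⟨fun i hi => Fin.ext (by omega), ⟨p - 1, by omega⟩,
      fun e => by rw [Fin.ext_iff] at e; dsimp at e; omega,
      fun j => by dsimp only; rw [Nat.sub_add_cancel hp]⟩)
  have hB := C.finsum_comm_ncdet (fun k => -C.glRaise p k)
    (fun s t : Fin (C.n - l + 1) => C.PhibarW (C.n - (s : ℕ)) (-(((t : ℕ) : ℤ) + 1)))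
    (fun s => C.n - (s : ℕ) = p) _ _
    (fun k i j => C.glRaise_comm_PhibarW hp hp' (by omega) (by omega) k _)
    (fun a ha => ⟨fun i hi => Fin.ext (by omega), ⟨C.n - (p + 1), by omega⟩,
      fun e => by rw [Fin.ext_iff] at e; dsimp at e; omega,
      fun j => by dsimp only; rw [Nat.sub_sub_self hp']⟩)
  have hneg : ∀ k, -C.glRaise p k * C.Abar l - C.Abar l * -C.glRaise p k
      = -(C.glRaise p k * C.Abar l - C.Abar l * C.glRaise p k) := fun k => by noncomm_ring
  change {k : ℤ | -C.glRaise p k * C.Abar l - C.Abar l * -C.glRaise p k ≠ 0}.Finite ∧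
    ∑ᶠ k : ℤ, (-C.glRaise p k * C.Abar l - C.Abar l * -C.glRaise p k) = 0 at hB
  simp only [hneg, neg_ne_zero, finsum_neg_distrib, neg_eq_zero] at hB
  exact ⟨hA.1, hB.1, hA.2, hB.2⟩
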